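/- Let f : ℝ^d → ℝ be C¹ with globally (β,ν)-Hölder gradient, β > 0, ν ∈ (0,1], and 0 < γ < (ν+1)/β. Let (x_n) be generated by x_{n+1} = x_n − γ_n ∇f(x_n) with γ_n = γ((ν+1)/β)^{1/ν − 1}‖∇f(x_n)‖^{1/ν − 1}. Suppose (x_n) is bounded, x* is a cluster point of (x_n), and f satisfies the Łojasiewicz inequality at x* with some constants η, C > 0 and exponent θ ∈ (0,1). Then (x_n) converges to x* and ∇f(x*) = 0. -/

import Mathlib

/-- The descent lemma for functions whose gradient is Hölder continuous. -/
theorem le_add_inner_add_of_holder_gradient {E : Type*} [NormedAddCommGroup E]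
    [InnerProductSpace ℝ E] [CompleteSpace E] {f : E → ℝ} (hf : Differentiable ℝ f) {β ν : ℝ}
    (hν : 0 < ν) (hH : ∀ x y : E, ‖gradient f x - gradient f y‖ ≤ β * ‖x - y‖ ^ ν) (x v : E) :
    f (x + v) ≤ f x + inner ℝ (gradient f x) v + β / (ν + 1) * ‖v‖ ^ (ν + 1) := by
  set h : ℝ → ℝ := fun t => f (x + t • v) - t * inner ℝ (gradient f x) v
    - β / (ν + 1) * ‖v‖ ^ (ν + 1) * t ^ (ν + 1) with hh
  have hd : ∀ t : ℝ, HasDerivAt h (inner ℝ (gradient f (x + t • v)) v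
      - inner ℝ (gradient f x) v - β * ‖v‖ ^ (ν + 1) * t ^ ν) t := by
    intro t
    have hline : HasDerivAt (fun t : ℝ => x + t • v) v t := by
      simpa using ((hasDerivAt_id t).smul_const v).const_add x
    have hcomp := ((hf (x + t • v)).hasGradientAt.hasFDerivAt).comp_hasDerivAt t hline
    have hpow := (Real.hasDerivAt_rpow_const (x := t) (p := ν + 1)
      (Or.inr (by linarith))).const_mul (β / (ν + 1) * ‖v‖ ^ (ν + 1))
    refine ((hcomp.sub ((hasDerivAt_id t).mul_const
      (inner ℝ (gradient f x) v))).sub hpow).congr_deriv ?_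
    have : ν + 1 ≠ 0 := by positivity
    simp only [InnerProductSpace.toDual_apply_apply, add_sub_cancel_right]
    field_simp
  have hanti : AntitoneOn h (Set.Icc 0 1) := by
    refine antitoneOn_of_deriv_nonpos (convex_Icc 0 1)
      (fun t _ => (hd t).continuousAt.continuousWithinAt)
      (fun t _ => (hd t).differentiableAt.differentiableWithinAt) fun t ht => ?_
    rw [interior_Icc] at ht
    rw [(hd t).deriv, ← inner_sub_left]
    have hgrad := hH (x + t • v) x
    rw [add_sub_cancel_left, norm_smul, Real.norm_of_nonneg ht.1.le,
      Real.mul_rpow ht.1.le (norm_nonneg v)] at hgrad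
    have hcs := (real_inner_le_norm (gradient f (x + t • v) - gradient f x) v).trans
      (mul_le_mul_of_nonneg_right hgrad (norm_nonneg v))
    rw [Real.rpow_add_one' (norm_nonneg v) (by positivity)]
    linarith
  have h01 := hanti (Set.left_mem_Icc.2 zero_le_one) (Set.right_mem_Icc.2 zero_le_one) zero_le_one
  simp only [hh, zero_smul, one_smul, add_zero, Real.one_rpow,
    Real.zero_rpow (by positivity : ν + 1 ≠ 0)] at h01
  linarith

/-- The tangent-line inequality for the concave function `t ↦ t ^ (1 - θ)`. -/
theorem mul_sub_le_rpow_sub_rpow {r q θ : ℝ} (hr : 0 < r) (hq : 0 ≤ q)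
    (hθ : θ ∈ Set.Ioo (0 : ℝ) 1) :
    (1 - θ) * (r - q) ≤ r ^ θ * (r ^ (1 - θ) - q ^ (1 - θ)) := by
  have hb := rpow_one_add_le_one_add_mul_self (s := q / r - 1) (p := 1 - θ)
    (by linarith [div_nonneg hq hr.le]) (by linarith [hθ.2]) (by linarith [hθ.1])
  rw [add_sub_cancel, Real.div_rpow hq hr.le, div_le_iff₀ (by positivity)] at hb
  have hmul : r ^ θ * r ^ (1 - θ) = r := by rw [← Real.rpow_add hr]; simp
  have hb' := mul_le_mul_of_nonneg_left hb (Real.rpow_nonneg hr.le θ)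
  have heq : r ^ θ * ((1 + (1 - θ) * (q / r - 1)) * r ^ (1 - θ)) = r + (1 - θ) * (q - r) := by
    rw [mul_left_comm, hmul]
    field_simp
  linarith

/-- A sequence with sufficient decrease for a function satisfying the Łojasiewicz inequality at a
cluster point converges to that cluster point. -/
theorem tendsto_of_sufficient_decrease_of_lojasiewicz {E : Type*} [NormedAddCommGroup E]
    {f g : E → ℝ} (hf : Continuous f) {x : ℕ → E} {c : ℝ} (hc : 0 < c)
    (hdec : ∀ n, c * (‖x (n + 1) - x n‖ * g (x n)) ≤ f (x n) - f (x (n + 1)))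
    (hg : ∀ n, 0 ≤ g (x n)) (hstat : ∀ n, g (x n) = 0 → x (n + 1) = x n)
    {xs : E} {φ : ℕ → ℕ} (hφ : StrictMono φ)
    (hlim : Filter.Tendsto (fun n => x (φ n)) Filter.atTop (nhds xs))
    {η C θ : ℝ} (hη : 0 < η) (hC : 0 < C) (hθ : θ ∈ Set.Ioo (0 : ℝ) 1)
    (hKL : ∀ y ∈ Metric.ball xs η, C * |f y - f xs| ^ θ ≤ g y) :
    Filter.Tendsto x Filter.atTop (nhds xs) := by
  have hanti : Antitone fun n => f (x n) := antitone_nat_of_succ_le fun n => by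
    have := hdec n
    have : 0 ≤ c * (‖x (n + 1) - x n‖ * g (x n)) :=
      mul_nonneg hc.le (mul_nonneg (norm_nonneg _) (hg n))
    linarith
  have hflim : Filter.Tendsto (fun n => f (x (φ n))) Filter.atTop (nhds (f xs)) :=
    (hf.tendsto xs).comp hlim
  have hge : ∀ n, f xs ≤ f (x n) := fun n =>
    le_of_tendsto hflim <| (Filter.eventually_ge_atTop n).mono fun k hk =>
      hanti (hk.trans (hφ.id_le k))
  have hθ' : 0 < 1 - θ := sub_pos.2 hθ.2
  set M : ℝ := ((1 - θ) * c * C)⁻¹ with hM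
  have hM0 : 0 < M := by positivity
  have hstep : ∀ n, x n ∈ Metric.ball xs η → ‖x (n + 1) - x n‖ ≤
      M * ((f (x n) - f xs) ^ (1 - θ) - (f (x (n + 1)) - f xs) ^ (1 - θ)) := by
    intro n hn
    rcases (sub_nonneg.2 (hge n)).eq_or_lt with h0 | hpos
    · have hz : ‖x (n + 1) - x n‖ * g (x n) = 0 := by
        have h1 := hdec n
        have h2 := hge (n + 1)
        have h3 : c * (‖x (n + 1) - x n‖ * g (x n)) ≤ c * 0 := by linarith
        exact le_antisymm (le_of_mul_le_mul_left h3 hc) (mul_nonneg (norm_nonneg _) (hg n))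
      have hx : x (n + 1) = x n := by
        rcases mul_eq_zero.1 hz with h | h
        · exact sub_eq_zero.1 (norm_eq_zero.1 h)
        · exact hstat n h
      simp [hx]
    · have hk := hKL _ hn
      rw [abs_of_pos hpos] at hk
      have hconc := mul_sub_le_rpow_sub_rpow hpos (sub_nonneg.2 (hge (n + 1))) hθ
      set r := f (x n) - f xs
      have hrθ : 0 < r ^ θ := Real.rpow_pos_of_pos hpos θ
      have h1 : c * (‖x (n + 1) - x n‖ * (C * r ^ θ)) ≤ f (x n) - f (x (n + 1)) :=
        le_trans (by gcongr) (hdec n)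
      have h2 := mul_le_mul_of_nonneg_left h1 hθ'.le
      rw [hM, inv_mul_eq_div, le_div_iff₀ (by positivity)]
      refine le_of_mul_le_mul_left ?_ hrθ
      have : (1 - θ) * (f (x n) - f (x (n + 1))) = (1 - θ) * (r - (f (x (n + 1)) - f xs)) := by
        ring
      linarith
  set Φ : ℕ → ℝ := fun n => ‖x n - xs‖ + M * (f (x n) - f xs) ^ (1 - θ) with hΦ
  have hnorm : ∀ n, ‖x n - xs‖ ≤ Φ n := fun n =>
    le_add_of_nonneg_right (mul_nonneg hM0.le (Real.rpow_nonneg (sub_nonneg.2 (hge n)) _))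
  have hΦstep : ∀ n, Φ n < η → Φ (n + 1) ≤ Φ n := fun n hn => by
    have h1 := hstep n (mem_ball_iff_norm.2 ((hnorm n).trans_lt hn))
    have h2 := norm_sub_le_norm_sub_add_norm_sub (x (n + 1)) (x n) xs
    simp only [hΦ]
    linarith
  have hΦlim : Filter.Tendsto (fun n => Φ (φ n)) Filter.atTop (nhds 0) := by
    have h1 : Filter.Tendsto (fun n => ‖x (φ n) - xs‖) Filter.atTop (nhds 0) :=
      tendsto_iff_norm_sub_tendsto_zero.1 hlim
    have h2 := (((hflim.sub_const (f xs)).rpow_const (p := 1 - θ) (Or.inr hθ'.le)).const_mul M)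
    simpa [hΦ, Real.zero_rpow hθ'.ne'] using h1.add h2
  rw [Metric.tendsto_atTop]
  intro ε hε
  obtain ⟨k, hk⟩ := (hΦlim.eventually (gt_mem_nhds (lt_min hε hη))).exists
  have hmono : ∀ n, φ k ≤ n → Φ n ≤ Φ (φ k) := fun n hn => by
    induction n, hn using Nat.le_induction with
    | base => exact le_rfl
    | succ n _ ih => exact (hΦstep n (ih.trans_lt (hk.trans_le (min_le_right _ _)))).trans ih
  refine ⟨φ k, fun n hn => ?_⟩
  rw [dist_eq_norm]
  exact (hnorm n).trans_lt ((hmono n hn).trans_lt (hk.trans_le (min_le_left _ _)))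

/-- Sufficient decrease for one step of the Hölder gradient method, with step-size factor `a`. -/
theorem holder_gradient_step_decrease {E : Type*} [NormedAddCommGroup E]
    [InnerProductSpace ℝ E] [CompleteSpace E] {f : E → ℝ} (hf : Differentiable ℝ f) {β ν a : ℝ}
    (hν : 0 < ν) (ha : 0 ≤ a)
    (hH : ∀ x y : E, ‖gradient f x - gradient f y‖ ≤ β * ‖x - y‖ ^ ν) {x y : E}
    (hy : y = x - (a * ‖gradient f x‖ ^ (1 / ν - 1)) • gradient f x) :
    (1 - β / (ν + 1) * a ^ ν) * (‖y - x‖ * ‖gradient f x‖) ≤ f x - f y := by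
  set G := ‖gradient f x‖ with hG
  have hG0 : 0 ≤ G := norm_nonneg _
  set v : E := -((a * G ^ (1 / ν - 1)) • gradient f x) with hv
  have hyv : y = x + v := by rw [hy, hv, sub_eq_add_neg]
  have hsub : y - x = v := by rw [hyv, add_sub_cancel_left]
  have hcoef : 0 ≤ a * G ^ (1 / ν - 1) := mul_nonneg ha (Real.rpow_nonneg hG0 _)
  have hvn : ‖v‖ = a * G ^ (1 / ν - 1) * G := by
    rw [hv, norm_neg, norm_smul, Real.norm_of_nonneg hcoef]
  have hvn' : ‖v‖ = a * G ^ (1 / ν) := by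
    have := Real.rpow_add_one' hG0 (y := 1 / ν - 1) (by rw [sub_add_cancel]; positivity)
    rw [sub_add_cancel] at this
    rw [hvn, this, mul_assoc]
  have hinner : inner ℝ (gradient f x) v = -(‖v‖ * G) := by
    rw [hv, inner_neg_right, real_inner_smul_right, real_inner_self_eq_norm_sq, ← hv, hvn]
    ring
  have hpow : ‖v‖ ^ (ν + 1) = a ^ ν * (‖v‖ * G) := by
    have : ‖v‖ ^ ν = a ^ ν * G := by
      rw [hvn', Real.mul_rpow ha (Real.rpow_nonneg hG0 _), ← Real.rpow_mul hG0,
        one_div_mul_cancel hν.ne', Real.rpow_one]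
    rw [Real.rpow_add_one' (norm_nonneg v) (by positivity), this]
    ring
  have hdesc := le_add_inner_add_of_holder_gradient hf hν hH x v
  rw [hinner, hpow, ← hyv] at hdesc
  rw [hsub]
  linarith


/-- **Convergence of the Hölder gradient method.** If the iterates are bounded, `x*` is a
cluster point, and `f` satisfies the Łojasiewicz inequality at `x*`, then the whole sequence
converges to `x*`, which is a critical point. -/
theorem holder_gradient_convergence {d : ℕ}
    (f : EuclideanSpace ℝ (Fin d) → ℝ) (hf : ContDiff ℝ 1 f)
    (β ν : ℝ) (hβ : 0 < β) (hν : ν ∈ Set.Ioc (0 : ℝ) 1)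
    (hH : ∀ x y : EuclideanSpace ℝ (Fin d),
      ‖gradient f x - gradient f y‖ ≤ β * ‖x - y‖ ^ ν)
    (γ : ℝ) (hγ : 0 < γ) (hγ' : γ < (ν + 1) / β)
    (x : ℕ → EuclideanSpace ℝ (Fin d)) (γn : ℕ → ℝ)
    (hγn : ∀ n, γn n = γ * ((ν + 1) / β) ^ (1 / ν - 1) * ‖gradient f (x n)‖ ^ (1 / ν - 1))
    (hstep : ∀ n, x (n + 1) = x n - γn n • gradient f (x n))
    (hbdd : Bornology.IsBounded (Set.range x))
    (xs : EuclideanSpace ℝ (Fin d))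
    (hcluster : ∃ φ : ℕ → ℕ, StrictMono φ ∧
      Filter.Tendsto (fun n => x (φ n)) Filter.atTop (nhds xs))
    (η C θ : ℝ) (hη : 0 < η) (hC : 0 < C) (hθ : θ ∈ Set.Ioo (0 : ℝ) 1)
    (hKL : ∀ y ∈ Metric.ball xs η, C * |f y - f xs| ^ θ ≤ ‖gradient f y‖) :
    Filter.Tendsto x Filter.atTop (nhds xs) ∧ gradient f xs = 0 := by
  obtain ⟨φ, hφ, hlim⟩ := hcluster
  obtain ⟨hν0, -⟩ := hν
  set L : ℝ := (ν + 1) / β with hL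
  have hL0 : 0 < L := by positivity
  set a : ℝ := γ * L ^ (1 / ν - 1) with ha
  have ha0 : 0 < a := by positivity
  have hfd : Differentiable ℝ f := hf.differentiable (by simp)
  have hc : 0 < 1 - β / (ν + 1) * a ^ ν := by
    have hexp : (1 / ν - 1) * ν = 1 - ν := by field_simp
    have hinv : β / (ν + 1) = L⁻¹ := by rw [hL, inv_div]
    have : β / (ν + 1) * a ^ ν = (γ / L) ^ ν := by
      rw [hinv, ha, Real.mul_rpow hγ.le (by positivity), ← Real.rpow_mul hL0.le, hexp,
        Real.rpow_sub hL0, Real.rpow_one, Real.div_rpow hγ.le hL0.le]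
      field_simp
    rw [this, sub_pos]
    exact Real.rpow_lt_one (by positivity) ((div_lt_one hL0).2 hγ') hν0
  have hstep' : ∀ n, x (n + 1) =
      x n - (a * ‖gradient f (x n)‖ ^ (1 / ν - 1)) • gradient f (x n) := fun n => by
    rw [hstep n, hγn n]
  have hconv : Filter.Tendsto x Filter.atTop (nhds xs) :=
    tendsto_of_sufficient_decrease_of_lojasiewicz (g := fun y => ‖gradient f y‖) hfd.continuous hc
      (fun n => holder_gradient_step_decrease hfd hν0 ha0.le hH (hstep' n))
      (fun n => norm_nonneg _)
      (fun n hn => by rw [hstep n, norm_eq_zero.1 hn, smul_zero, sub_zero]) hφ hlim hη hC hθ hKL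
  refine ⟨hconv, ?_⟩
  have hgrad : Continuous (gradient f) :=
    (InnerProductSpace.toDual ℝ (EuclideanSpace ℝ (Fin d))).symm.continuous.comp
      (hf.continuous_fderiv (by simp))
  have hnorm : ∀ n, ‖x (n + 1) - x n‖ = a * ‖gradient f (x n)‖ ^ (1 / ν) := fun n => by
    have := Real.rpow_add_one' (norm_nonneg (gradient f (x n))) (y := 1 / ν - 1)
      (by rw [sub_add_cancel]; positivity)
    rw [sub_add_cancel] at this
    rw [hstep' n, sub_sub_cancel_left, norm_neg, norm_smul, Real.norm_of_nonneg (by positivity),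
      this, mul_assoc]
  have h0 : Filter.Tendsto (fun n => ‖x (n + 1) - x n‖) Filter.atTop (nhds 0) := by
    simpa using (((Filter.tendsto_add_atTop_iff_nat 1).2 hconv).sub hconv).norm
  have h1 : Filter.Tendsto (fun n => ‖x (n + 1) - x n‖) Filter.atTop
      (nhds (a * ‖gradient f xs‖ ^ (1 / ν))) := by
    simp only [hnorm]
    exact ((((hgrad.tendsto xs).comp hconv).norm).rpow_const
      (Or.inr (by positivity))).const_mul a
  have hzero := (mul_eq_zero.1 (tendsto_nhds_unique h1 h0)).resolve_left ha0.ne'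
  exact norm_eq_zero.1 ((Real.rpow_eq_zero (norm_nonneg _) (by positivity)).1 hzero)
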